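/- arXiv:2310.14145 — 2 statements merged into one kernel-verified Lean document; each statement's English description precedes it below -/
import Mathlib

section
/- The group G is contracting: there exists a finite subset N ⊆ G such that for every g ∈ G there exists k ∈ ℕ with g|_v ∈ N for every word v ∈ {0,1}* of length at least k. -/
namespace BVTree

/-- States of the automaton (generators, their inverses, and the identity). -/
inductive Q : Type
  | e | qa | qb | qc | qd | qa' | qb' | qc' | qd'
  deriving DecidableEq

open Q

/-- Output function of the automaton. -/
def Qout : Q → Bool → Bool
  | qa, x => !x
  | qa', x => !x
  | _, x => x

/-- Transition function of the automaton. -/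
def Qtrans : Q → Bool → Q
  | qa, false => qd
  | qa, true => e
  | qb, false => qa
  | qb, true => qc
  | qc, _ => qa
  | qd, false => e
  | qd, true => qb
  | qa', false => e
  | qa', true => qd'
  | qb', false => qa'
  | qb', true => qc'
  | qc', _ => qa'
  | qd', false => e
  | qd', true => qb'
  | e, _ => e

/-- The state corresponding to the inverse automorphism. -/
def Qinv : Q → Q
  | e => e
  | qa => qa' | qb => qb' | qc => qc' | qd => qd'
  | qa' => qa | qb' => qb | qc' => qc | qd' => qd

/-- The action of a state on finite binary words. -/
def act : Q → List Bool → List Bool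
  | _, [] => []
  | q, x :: w => Qout q x :: act (Qtrans q x) w

lemma act_inv (q : Q) : ∀ w, act (Qinv q) (act q w) = w := by
  intro w
  induction w generalizing q with
  | nil => rfl
  | cons x w ih =>
    have h1 : Qout (Qinv q) (Qout q x) = x := by cases q <;> cases x <;> rfl
    have h2 : Qtrans (Qinv q) (Qout q x) = Qinv (Qtrans q x) := by
      cases q <;> cases x <;> rfl
    simp [act, h1, h2, ih]

/-- The tree automorphism determined by a state of the automaton. -/
def aut (q : Q) : Equiv.Perm (List Bool) where
  toFun := act q
  invFun := act (Qinv q)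
  left_inv := act_inv q
  right_inv := by
    intro w
    have h : Qinv (Qinv q) = q := by cases q <;> rfl
    simpa [h] using act_inv (Qinv q) w

/-- The automorphism `a`: `a(0w) = 1·d(w)`, `a(1w) = 0·w`. -/
def a : Equiv.Perm (List Bool) := aut qa
/-- The automorphism `b`: `b(0w) = 0·a(w)`, `b(1w) = 1·c(w)`. -/
def b : Equiv.Perm (List Bool) := aut qb
/-- The automorphism `c`: `c(0w) = 0·a(w)`, `c(1w) = 1·a(w)`. -/
def c : Equiv.Perm (List Bool) := aut qc
/-- The automorphism `d`: `d(0w) = 0·w`, `d(1w) = 1·b(w)`. -/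
def d : Equiv.Perm (List Bool) := aut qd

/-- The group `G` generated by `a`, `b`, `c`, `d`. -/
def G : Subgroup (Equiv.Perm (List Bool)) := Subgroup.closure {a, b, c, d}


/-- Number of states of the nucleus. -/
def nN : ℕ := 67

/-- The nucleus automaton: activity and the two sections of each state. State `0` is the identity. -/
def ntab : List (Bool × ℕ × ℕ) :=
  [(false, 0, 0), (true, 4, 0), (false, 1, 3), (false, 1, 1), (false, 0, 2),
   (true, 0, 8), (false, 5, 7), (false, 5, 5), (false, 0, 6), (false, 4, 4),
   (true, 13, 1), (false, 1, 12), (false, 9, 10), (true, 11, 0), (true, 1, 29),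
   (true, 1, 27), (true, 0, 28), (false, 8, 8), (true, 0, 30), (true, 25, 5),
   (false, 0, 23), (false, 5, 24), (false, 17, 26), (true, 16, 5), (false, 0, 15),
   (false, 5, 14), (true, 5, 18), (true, 21, 0), (false, 1, 20), (false, 1, 19),
   (false, 5, 22), (true, 1, 51), (true, 9, 49), (false, 50, 0), (false, 54, 0),
   (true, 1, 53), (true, 1, 52), (true, 45, 0), (false, 1, 43), (true, 44, 5),
   (true, 48, 17), (false, 5, 47), (false, 17, 46), (true, 33, 0), (false, 0, 32),
   (true, 31, 5), (true, 0, 36), (true, 0, 34), (true, 5, 35), (true, 39, 1),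
   (false, 1, 38), (false, 9, 37), (true, 42, 5), (false, 0, 40), (false, 5, 41),
   (false, 66, 1), (true, 1, 65), (true, 9, 64), (true, 63, 5), (false, 5, 62),
   (true, 61, 17), (true, 0, 57), (true, 1, 55), (false, 56, 5), (true, 60, 0),
   (false, 1, 58), (true, 59, 5)]

/-- Multiplication table: entry `j` of row `i` is the state equal to `i` times the `j`-th state of
`Q`, or `nN` if that product is not in the nucleus. -/
def mtab : List (List ℕ) :=
  [[0, 1, 2, 3, 4, 5, 6, 7, 8], [1, 9, 67, 10, 67, 0, 67, 67, 67],
   [2, 67, 67, 67, 11, 67, 0, 67, 67], [3, 67, 12, 67, 67, 67, 67, 0, 67],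
   [4, 13, 67, 67, 67, 67, 67, 67, 0], [5, 0, 14, 15, 16, 17, 67, 67, 18],
   [6, 19, 0, 20, 21, 67, 67, 22, 67], [7, 23, 24, 0, 25, 26, 67, 67, 67],
   [8, 27, 28, 29, 0, 67, 30, 67, 67], [9, 67, 67, 67, 67, 1, 67, 67, 67],
   [10, 67, 67, 67, 67, 67, 67, 1, 67], [11, 67, 67, 67, 67, 67, 67, 67, 2],
   [12, 67, 67, 67, 67, 67, 3, 67, 67], [13, 67, 67, 67, 67, 4, 67, 67, 67],
   [14, 67, 67, 67, 31, 67, 5, 67, 67], [15, 67, 32, 67, 67, 67, 67, 5, 67],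
   [16, 33, 67, 67, 67, 67, 67, 67, 5], [17, 5, 67, 67, 67, 67, 67, 67, 67],
   [18, 34, 35, 36, 5, 67, 67, 67, 67], [19, 67, 67, 37, 67, 6, 67, 67, 67],
   [20, 67, 38, 67, 67, 67, 67, 6, 67], [21, 39, 67, 67, 67, 67, 67, 67, 6],
   [22, 40, 41, 6, 42, 67, 67, 67, 67], [23, 67, 67, 43, 67, 7, 67, 67, 67],
   [24, 67, 67, 67, 44, 67, 7, 67, 67], [25, 45, 67, 67, 67, 67, 67, 67, 7],
   [26, 7, 46, 47, 48, 67, 67, 67, 67], [27, 67, 67, 49, 67, 8, 67, 67, 67],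
   [28, 67, 67, 67, 50, 67, 8, 67, 67], [29, 67, 51, 67, 67, 67, 67, 8, 67],
   [30, 52, 8, 53, 54, 67, 67, 67, 67], [31, 67, 67, 67, 67, 67, 67, 67, 14],
   [32, 67, 67, 67, 67, 67, 15, 67, 67], [33, 67, 67, 67, 67, 16, 67, 67, 67],
   [34, 67, 67, 55, 67, 18, 67, 67, 67], [35, 67, 67, 67, 56, 67, 18, 67, 67],
   [36, 67, 57, 67, 67, 67, 67, 18, 67], [37, 67, 67, 67, 67, 67, 67, 19, 67],
   [38, 67, 67, 67, 67, 67, 20, 67, 67], [39, 67, 67, 67, 67, 21, 67, 67, 67],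
   [40, 67, 67, 58, 67, 22, 67, 67, 67], [41, 67, 67, 67, 59, 67, 22, 67, 67],
   [42, 60, 67, 67, 67, 67, 67, 67, 22], [43, 67, 67, 67, 67, 67, 67, 23, 67],
   [44, 67, 67, 67, 67, 67, 67, 67, 24], [45, 67, 67, 67, 67, 25, 67, 67, 67],
   [46, 67, 67, 67, 61, 67, 26, 67, 67], [47, 67, 62, 67, 67, 67, 67, 26, 67],
   [48, 63, 67, 67, 67, 67, 67, 67, 26], [49, 67, 67, 67, 67, 67, 67, 27, 67],
   [50, 67, 67, 67, 67, 67, 67, 67, 28], [51, 67, 67, 67, 67, 67, 29, 67, 67],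
   [52, 67, 67, 64, 67, 30, 67, 67, 67], [53, 67, 65, 67, 67, 67, 67, 30, 67],
   [54, 66, 67, 67, 67, 67, 67, 67, 30], [55, 67, 67, 67, 67, 67, 67, 34, 67],
   [56, 67, 67, 67, 67, 67, 67, 67, 35], [57, 67, 67, 67, 67, 67, 36, 67, 67],
   [58, 67, 67, 67, 67, 67, 67, 40, 67], [59, 67, 67, 67, 67, 67, 67, 67, 41],
   [60, 67, 67, 67, 67, 42, 67, 67, 67], [61, 67, 67, 67, 67, 67, 67, 67, 46],
   [62, 67, 67, 67, 67, 67, 47, 67, 67], [63, 67, 67, 67, 67, 48, 67, 67, 67],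
   [64, 67, 67, 67, 67, 67, 67, 52, 67], [65, 67, 67, 67, 67, 67, 53, 67, 67],
   [66, 67, 67, 67, 67, 54, 67, 67, 67]]

/-- A state `i > 0` equals the product of an earlier state and an element of `Q`. -/
def ptab : List (ℕ × Q) :=
  [(0, e), (0, qa), (0, qb), (0, qc), (0, qd), (0, qa'), (0, qb'), (0, qc'),
   (0, qd'), (1, qa), (1, qc), (2, qd), (3, qb), (4, qa), (5, qb), (5, qc),
   (5, qd), (5, qa'), (5, qd'), (6, qa), (6, qc), (6, qd), (6, qc'), (7, qa),
   (7, qb), (7, qd), (7, qa'), (8, qa), (8, qb), (8, qc), (8, qb'), (14, qd),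
   (15, qb), (16, qa), (18, qa), (18, qb), (18, qc), (19, qc), (20, qb), (21, qa),
   (22, qa), (22, qb), (22, qd), (23, qc), (24, qd), (25, qa), (26, qb), (26, qc),
   (26, qd), (27, qc), (28, qd), (29, qb), (30, qa), (30, qc), (30, qd), (34, qc),
   (35, qd), (36, qb), (40, qc), (41, qd), (42, qa), (46, qd), (47, qb), (48, qa),
   (52, qc), (53, qb), (54, qa)]

/-- All states. -/
def allQ : List Q := [e, qa, qb, qc, qd, qa', qb', qc', qd']

/-- Position of a state in `allQ`. -/
def qidx : Q → ℕ
  | e => 0 | qa => 1 | qb => 2 | qc => 3 | qd => 4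
  | qa' => 5 | qb' => 6 | qc' => 7 | qd' => 8

/-- Output of the nucleus automaton. -/
def nout (i : ℕ) (x : Bool) : Bool := xor (ntab.getD i (false, 0, 0)).1 x

/-- Transition of the nucleus automaton. -/
def ntr (i : ℕ) (x : Bool) : ℕ :=
  match x with
  | false => (ntab.getD i (false, 0, 0)).2.1
  | true => (ntab.getD i (false, 0, 0)).2.2

/-- Lookup in the multiplication table. -/
def mul (i : ℕ) (q : Q) : ℕ := (mtab.getD i []).getD (qidx q) nN

/-- Action of the states of the nucleus automaton. -/
def nact : ℕ → List Bool → List Bool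
  | _, [] => []
  | i, x :: w => nout i x :: nact (ntr i x) w

/-- All sections of the product of `i` and `q` at level `k` are in the nucleus. -/
def good : ℕ → ℕ → Q → Bool
  | 0, i, q => Nat.blt (mul i q) nN
  | k + 1, i, q => good k (ntr i (Qout q false)) (Qtrans q false) &&
      good k (ntr i (Qout q true)) (Qtrans q true)

/-- Local consistency of one entry of the multiplication table. -/
def okMul (i : ℕ) (q : Q) (x : Bool) : Bool :=
  Nat.ble nN (mul i q) ||
    (nout i (Qout q x) == nout (mul i q) x &&
      Nat.beq (mul (ntr i (Qout q x)) (Qtrans q x)) (ntr (mul i q) x) &&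
      Nat.blt (ntr (mul i q) x) nN)

lemma check_mul : ((List.range nN).all fun i => allQ.all fun q =>
    okMul i q false && okMul i q true) = true := by decide +kernel

lemma check_good : ((List.range nN).all fun i => allQ.all fun q => good 7 i q) = true := by
  decide +kernel

lemma check_lt : ((List.range nN).all fun i =>
    Nat.blt (ntr i false) nN && Nat.blt (ntr i true) nN) = true := by decide +kernel

lemma check_par : ((List.range nN).all fun i => Nat.beq i 0 ||
    (Nat.blt (ptab.getD i (0, e)).1 i &&
      Nat.beq (mul (ptab.getD i (0, e)).1 (ptab.getD i (0, e)).2) i)) = true := by decide +kernel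

lemma mem_allQ (q : Q) : q ∈ allQ := by cases q <;> simp [allQ]

lemma ntr_lt {i : ℕ} (hi : i < nN) (x : Bool) : ntr i x < nN := by
  have h := List.all_eq_true.1 check_lt i (List.mem_range.2 hi)
  simp only [Bool.and_eq_true, Nat.blt_eq] at h
  cases x
  · exact h.1
  · exact h.2

lemma mul_step {i : ℕ} (hi : i < nN) (q : Q) (hm : mul i q < nN) (x : Bool) :
    nout i (Qout q x) = nout (mul i q) x ∧
      mul (ntr i (Qout q x)) (Qtrans q x) = ntr (mul i q) x := by
  have h := List.all_eq_true.1 (List.all_eq_true.1 check_mul i (List.mem_range.2 hi)) q (mem_allQ q)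
  have h2 : okMul i q x = true := by
    rw [Bool.and_eq_true] at h
    cases x
    · exact h.1
    · exact h.2
  simp only [okMul, Bool.or_eq_true, Bool.and_eq_true, Nat.ble_eq, Nat.blt_eq, beq_iff_eq,
    Nat.beq_eq] at h2
  rcases h2 with h2 | h2
  · omega
  · exact h2.1

lemma nact_mul (w : List Bool) : ∀ (i : ℕ) (q : Q), i < nN → mul i q < nN →
    nact i (act q w) = nact (mul i q) w := by
  induction w with
  | nil => intro i q _ _; rfl
  | cons x w ih =>
    intro i q hi hm
    obtain ⟨h1, h2⟩ := mul_step hi q hm x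
    have h3 := ih (ntr i (Qout q x)) (Qtrans q x) (ntr_lt hi _) (by rw [h2]; exact ntr_lt hm x)
    simp only [act, nact]
    rw [h1, h3, h2]

lemma nact_good (k : ℕ) : ∀ (i : ℕ) (q : Q), i < nN → good k i q = true →
    ∀ v : List Bool, v.length = k → ∃ j < nN, ∀ w,
      nact i (act q (v ++ w)) = nact i (act q v) ++ nact j w := by
  induction k with
  | zero =>
    intro i q hi hg v hv
    obtain rfl := List.length_eq_zero_iff.1 hv
    simp only [good, Nat.blt_eq] at hg
    exact ⟨mul i q, hg, fun w => by simpa [act, nact] using nact_mul w i q hi hg⟩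
  | succ k ih =>
    intro i q hi hg v hv
    cases v with
    | nil => simp at hv
    | cons x v =>
      have hg' : good k (ntr i (Qout q x)) (Qtrans q x) = true := by
        simp only [good, Bool.and_eq_true] at hg
        cases x
        · exact hg.1
        · exact hg.2
      obtain ⟨j, hj, h⟩ := ih _ _ (ntr_lt hi _) hg' v (by simpa using hv)
      exact ⟨j, hj, fun w => by simp [act, nact, h w]⟩

lemma nact_zero (w : List Bool) : nact 0 w = w := by
  induction w with
  | nil => rfl
  | cons x w ih =>
    have h1 : nout 0 x = x := by cases x <;> rfl
    have h2 : ntr 0 x = 0 := by cases x <;> rfl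
    rw [nact, h1, h2, ih]

lemma aut_e : aut e = 1 := by
  ext1 w
  change act e w = w
  induction w with
  | nil => rfl
  | cons x w ih => simp [act, Qout, Qtrans, ih]

lemma aut_inv (q : Q) : (aut q)⁻¹ = aut (Qinv q) := by
  ext1 w
  rfl

lemma aut_mem (q : Q) : aut q ∈ G := by
  have ha : aut qa ∈ G := Subgroup.subset_closure (by simp [a])
  have hb : aut qb ∈ G := Subgroup.subset_closure (by simp [b])
  have hc : aut qc ∈ G := Subgroup.subset_closure (by simp [c])
  have hd : aut qd ∈ G := Subgroup.subset_closure (by simp [d])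
  cases q with
  | e => rw [aut_e]; exact G.one_mem
  | qa => exact ha
  | qb => exact hb
  | qc => exact hc
  | qd => exact hd
  | qa' => exact aut_inv qa ▸ G.inv_mem ha
  | qb' => exact aut_inv qb ▸ G.inv_mem hb
  | qc' => exact aut_inv qc ▸ G.inv_mem hc
  | qd' => exact aut_inv qd ▸ G.inv_mem hd

lemma nact_mem (i : ℕ) : i < nN → ∃ p : Equiv.Perm (List Bool), p ∈ G ∧ ∀ w, p w = nact i w := by
  induction i using Nat.strong_induction_on with
  | _ i ih =>
    intro hi
    have h := List.all_eq_true.1 check_par i (List.mem_range.2 hi)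
    simp only [Bool.or_eq_true, Bool.and_eq_true, Nat.blt_eq, Nat.beq_eq] at h
    rcases h with rfl | ⟨h1, h2⟩
    · exact ⟨1, G.one_mem, fun w => (nact_zero w).symm⟩
    · generalize (ptab.getD i (0, e)).1 = j at h1 h2
      generalize (ptab.getD i (0, e)).2 = q at h2
      obtain ⟨p, hp, hw⟩ := ih j h1 (h1.trans hi)
      refine ⟨p * aut q, G.mul_mem hp (aut_mem q), fun w => ?_⟩
      have h3 := nact_mul w j q (h1.trans hi) (by rw [h2]; exact hi)
      rw [h2] at h3
      rw [← h3, ← hw]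
      rfl

/-- Section of a state along a word. -/
def Qsec : Q → List Bool → Q
  | q, [] => q
  | q, x :: w => Qsec (Qtrans q x) w

lemma act_append (v w : List Bool) : ∀ q, act q (v ++ w) = act q v ++ act (Qsec q v) w := by
  induction v with
  | nil => intro q; rfl
  | cons x v ih => intro q; simp [act, Qsec, ih]

lemma act_length (v : List Bool) : ∀ q, (act q v).length = v.length := by
  induction v with
  | nil => intro q; rfl
  | cons x v ih => intro q; simp [act, ih]

/-- Every section of `g` below some level is given by a state of the nucleus. -/
def Contr (g : Equiv.Perm (List Bool)) : Prop :=
  ∃ k : ℕ, ∀ v : List Bool, k ≤ v.length → ∃ i < nN, ∀ w, g (v ++ w) = g v ++ nact i w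

lemma contr_mul (g : Equiv.Perm (List Bool)) (q : Q) (hg : Contr g) : Contr (g * aut q) := by
  obtain ⟨k, hk⟩ := hg
  refine ⟨k + 7, fun v hv => ?_⟩
  obtain ⟨v₁, v₂, rfl, h2⟩ : ∃ v₁ v₂ : List Bool, v = v₁ ++ v₂ ∧ v₂.length = 7 :=
    ⟨v.take (v.length - 7), v.drop (v.length - 7), (List.take_append_drop _ _).symm, by
      rw [List.length_drop]; omega⟩
  rw [List.length_append] at hv
  obtain ⟨i, hi, h⟩ := hk (act q v₁) (by rw [act_length]; omega)
  have hgood := List.all_eq_true.1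
    (List.all_eq_true.1 check_good i (List.mem_range.2 hi)) (Qsec q v₁) (mem_allQ _)
  obtain ⟨j, hj, h'⟩ := nact_good 7 i (Qsec q v₁) hi hgood v₂ h2
  refine ⟨j, hj, fun w => ?_⟩
  change g (act q (v₁ ++ v₂ ++ w)) = g (act q (v₁ ++ v₂)) ++ nact j w
  rw [List.append_assoc, act_append v₁ (v₂ ++ w), act_append v₁ v₂, h, h, h', List.append_assoc]

lemma contr (g : Equiv.Perm (List Bool)) (hg : g ∈ G) : Contr g := by
  have key : ∀ y ∈ ({a, b, c, d} : Set (Equiv.Perm (List Bool))), ∃ q, y = aut q := by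
    intro y hy
    simp only [Set.mem_insert_iff, Set.mem_singleton_iff] at hy
    rcases hy with rfl | rfl | rfl | rfl
    exacts [⟨qa, rfl⟩, ⟨qb, rfl⟩, ⟨qc, rfl⟩, ⟨qd, rfl⟩]
  refine Subgroup.closure_induction_right (p := fun g _ => Contr g) ?_ ?_ ?_ hg
  · exact ⟨0, fun v _ => ⟨0, by decide, fun w => by simp [nact_zero]⟩⟩
  · intro x _ y hy hx
    obtain ⟨q, rfl⟩ := key y hy
    exact contr_mul x q hx
  · intro x _ y hy hx
    obtain ⟨q, rfl⟩ := key y hy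
    rw [aut_inv]
    exact contr_mul x (Qinv q) hx

/-- `G` is contracting: there is a finite subset `N ⊆ G` such that for every
`g ∈ G` there is `k` with the section of `g` at every word of length `≥ k` lying in `N`. -/
theorem contracting :
    ∃ N : Finset (Equiv.Perm (List Bool)), ↑N ⊆ (G : Set (Equiv.Perm (List Bool))) ∧
      ∀ g ∈ G, ∃ k : ℕ, ∀ v : List Bool, k ≤ v.length →
        ∃ x ∈ N, ∀ w : List Bool, g (v ++ w) = g v ++ x w := by
  classical
  choose f hf using fun i : Fin nN => nact_mem i.1 i.2
  refine ⟨Finset.univ.image f, ?_, ?_⟩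
  · intro p hp
    simp only [Finset.coe_image, Set.mem_image] at hp
    obtain ⟨i, -, rfl⟩ := hp
    exact (hf i).1
  · intro g hg
    obtain ⟨k, hk⟩ := contr g hg
    refine ⟨k, fun v hv => ?_⟩
    obtain ⟨i, hi, h⟩ := hk v hv
    refine ⟨f ⟨i, hi⟩, Finset.mem_image_of_mem _ (Finset.mem_univ _), fun w => ?_⟩
    rw [h w, (hf ⟨i, hi⟩).2 w]

end BVTree
end

section
/- Let U be the finite subset of G consisting of the elements a, b, d, c, da, bd, cb, ac, a⁻¹b, d⁻¹c, a⁻¹c, d⁻¹a, b⁻¹d, c⁻¹b, a², a⁻¹da, d⁻¹bd, b⁻¹cb, c⁻¹ac, a⁻¹bd, d⁻¹cb, b⁻¹ac, c⁻¹da, a⁻¹cb, d⁻¹ac, b⁻¹da, c⁻¹bd, a⁻¹d⁻¹bd, d⁻¹b⁻¹cb, b⁻¹c⁻¹ac, c⁻¹a⁻¹da, a⁻¹d⁻¹cb, d⁻¹b⁻¹ac, and let N = {1} ∪ U ∪ U⁻¹. Then for every generator s ∈ {a, b, c, d, a⁻¹, b⁻¹, c⁻¹, d⁻¹}, every x ∈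 N, and every word v ∈ {0,1}* of length 7, the section (s·x)|_v belongs to N. -/
namespace BVTree

open Q

/-- The set `U` from the paper's nucleus construction. -/
def U : Set (Equiv.Perm (List Bool)) :=
  {a, b, d, c, d * a, b * d, c * b, a * c, a⁻¹ * b, d⁻¹ * c, a⁻¹ * c, d⁻¹ * a,
   b⁻¹ * d, c⁻¹ * b, a ^ 2, a⁻¹ * d * a, d⁻¹ * b * d, b⁻¹ * c * b, c⁻¹ * a * c,
   a⁻¹ * b * d, d⁻¹ * c * b, b⁻¹ * a * c, c⁻¹ * d * a, a⁻¹ * c * b, d⁻¹ * a * c,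
   b⁻¹ * d * a, c⁻¹ * b * d, a⁻¹ * d⁻¹ * b * d, d⁻¹ * b⁻¹ * c * b,
   b⁻¹ * c⁻¹ * a * c, c⁻¹ * a⁻¹ * d * a, a⁻¹ * d⁻¹ * c * b, d⁻¹ * b⁻¹ * a * c}

/-- The nucleus `N = {1} ∪ U ∪ U⁻¹`. -/
def N : Set (Equiv.Perm (List Bool)) := {1} ∪ U ∪ U⁻¹

/-- Evaluation of a word in the states as a permutation. -/
def ev : List Q → Equiv.Perm (List Bool)
  | [] => 1
  | q :: w => aut q * ev w

/-- Left multiplication of a word by a state, with free reduction. -/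
def push (q : Q) (u : List Q) : List Q :=
  if q = e then u else
    match u with
    | [] => [q]
    | p :: t => if p = Qinv q then t else q :: p :: t

/-- Section and output letter of a word at a letter. -/
def sec : List Q → Bool → List Q × Bool
  | [], x => ([], x)
  | q :: w, x => (push (Qtrans q (sec w x).2) (sec w x).1, Qout q (sec w x).2)

/-- The words of `U`. -/
def Ulist : List (List Q) :=
  [[qa], [qb], [qd], [qc], [qd, qa], [qb, qd], [qc, qb], [qa, qc], [qa', qb], [qd', qc],
   [qa', qc], [qd', qa], [qb', qd], [qc', qb], [qa, qa], [qa', qd, qa], [qd', qb, qd],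
   [qb', qc, qb], [qc', qa, qc], [qa', qb, qd], [qd', qc, qb], [qb', qa, qc], [qc', qd, qa],
   [qa', qc, qb], [qd', qa, qc], [qb', qd, qa], [qc', qb, qd], [qa', qd', qb, qd],
   [qd', qb', qc, qb], [qb', qc', qa, qc], [qc', qa', qd, qa], [qa', qd', qc, qb],
   [qd', qb', qa, qc]]

/-- Inverse of a word. -/
def winv (w : List Q) : List Q := (w.map Qinv).reverse

/-- The words of `N`. -/
def Nlist : List (List Q) := [] :: (Ulist ++ Ulist.map winv)

/-- All sections of `w` at level `k` lie in `Nlist`. -/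
def chk : ℕ → List Q → Bool
  | 0, w => Nlist.elem w
  | k + 1, w => Nlist.elem w || (chk k (sec w false).1 && chk k (sec w true).1)

lemma aut_Qinv (q : Q) : aut (Qinv q) = (aut q)⁻¹ := by
  ext1 v; rfl

lemma ev_append (u v : List Q) : ev (u ++ v) = ev u * ev v := by
  induction u with
  | nil => simp [ev]
  | cons q u ih => simp [ev, ih, mul_assoc]

lemma ev_winv (w : List Q) : ev (winv w) = (ev w)⁻¹ := by
  induction w with
  | nil => simp [ev, winv]
  | cons q w ih =>
    have : winv (q :: w) = winv w ++ [Qinv q] := by simp [winv]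
    rw [this, ev_append, ih]
    simp [ev, aut_Qinv]

lemma ev_push (q : Q) (u : List Q) : ev (push q u) = aut q * ev u := by
  unfold push
  split_ifs with h
  · simp [h, aut_e]
  · cases u with
    | nil => rfl
    | cons p t =>
      dsimp only
      split_ifs with h'
      · simp [ev, h', aut_Qinv]
      · rfl

lemma ev_nil (w : List Q) : ev w [] = [] := by
  induction w with
  | nil => rfl
  | cons q w ih => simp only [ev, Equiv.Perm.mul_apply, ih]; rfl

lemma ev_cons (w : List Q) (x : Bool) (v : List Bool) :
    ev w (x :: v) = (sec w x).2 :: ev (sec w x).1 v := by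
  induction w with
  | nil => rfl
  | cons q w ih =>
    simp only [ev, Equiv.Perm.mul_apply, ih, sec, ev_push]
    rfl

lemma Nlist_closed : ∀ w ∈ Nlist, ∀ x : Bool, (sec w x).1 ∈ Nlist := by
  decide +kernel

lemma mem_sound (v : List Bool) : ∀ w ∈ Nlist,
    ∃ y ∈ Nlist, ∀ u, ev w (v ++ u) = ev w v ++ ev y u := by
  induction v with
  | nil => exact fun w hw => ⟨w, hw, fun u => by simp [ev_nil]⟩
  | cons x v ih =>
    intro w hw
    obtain ⟨y, hy, h⟩ := ih _ (Nlist_closed w hw x)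
    exact ⟨y, hy, fun u => by simp [ev_cons, h]⟩

lemma chk_sound (v : List Bool) : ∀ w, chk v.length w = true →
    ∃ y ∈ Nlist, ∀ u, ev w (v ++ u) = ev w v ++ ev y u := by
  induction v with
  | nil =>
    intro w hw
    exact mem_sound _ w (by simpa [chk] using hw)
  | cons x v ih =>
    intro w hw
    simp only [List.length_cons, chk, Bool.or_eq_true, Bool.and_eq_true, List.elem_eq_mem,
      decide_eq_true_eq] at hw
    rcases hw with hw | hw
    · exact mem_sound _ w hw
    · have hx : chk v.length (sec w x).1 = true := by
        cases x
        · exact hw.1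
        · exact hw.2
      obtain ⟨y, hy, h⟩ := ih _ hx
      exact ⟨y, hy, fun u => by simp [ev_cons, h]⟩

lemma chk_all : ∀ q ∈ [qa, qb, qc, qd, qa', qb', qc', qd'], ∀ w ∈ Nlist,
    chk 7 (push q w) = true := by
  decide +kernel

lemma mem_U (x : Equiv.Perm (List Bool)) : x ∈ U ↔ x ∈ Ulist.map ev := by
  have ha : aut qa' = a⁻¹ := aut_Qinv qa
  have hb : aut qb' = b⁻¹ := aut_Qinv qb
  have hc : aut qc' = c⁻¹ := aut_Qinv qc
  have hd : aut qd' = d⁻¹ := aut_Qinv qd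
  have ha1 : aut qa = a := rfl
  have hb1 : aut qb = b := rfl
  have hc1 : aut qc = c := rfl
  have hd1 : aut qd = d := rfl
  simp only [U, Ulist, List.map_cons, List.map_nil, ev, ha, hb, hc, hd, ha1, hb1, hc1, hd1,
    mul_one, mul_assoc, pow_two, Set.mem_insert_iff, Set.mem_singleton_iff, List.mem_cons,
    List.not_mem_nil, or_false]

lemma mem_N (x : Equiv.Perm (List Bool)) : x ∈ N ↔ ∃ w ∈ Nlist, ev w = x := by
  have h : x ∈ N ↔ x = 1 ∨ x ∈ U ∨ x⁻¹ ∈ U := by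
    simp [N, or_assoc]
  rw [h, mem_U, mem_U]
  simp only [Nlist, List.mem_cons, List.mem_append, List.mem_map]
  constructor
  · rintro (rfl | ⟨w, hw, rfl⟩ | ⟨w, hw, h⟩)
    · exact ⟨[], Or.inl rfl, rfl⟩
    · exact ⟨w, Or.inr (Or.inl hw), rfl⟩
    · exact ⟨winv w, Or.inr (Or.inr ⟨w, hw, rfl⟩), by rw [ev_winv, h, inv_inv]⟩
  · rintro ⟨w, rfl | hw | ⟨w, hw, rfl⟩, rfl⟩
    · exact Or.inl rfl
    · exact Or.inr (Or.inl ⟨w, hw, rfl⟩)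
    · exact Or.inr (Or.inr ⟨w, hw, by rw [ev_winv, inv_inv]⟩)

/-- for every generator `s`, every `x ∈ N` and every word `v` of length `7`,
the section of `s·x` at `v` lies in `N`. -/
theorem nucleus_absorbs_generators :
    ∀ s ∈ ({a, b, c, d, a⁻¹, b⁻¹, c⁻¹, d⁻¹} : Set (Equiv.Perm (List Bool))),
      ∀ x ∈ N, ∀ v : List Bool, v.length = 7 →
        ∃ y ∈ N, ∀ w : List Bool, (s * x) (v ++ w) = (s * x) v ++ y w := by
  intro s hs x hx v hv
  obtain ⟨n, hn, rfl⟩ := (mem_N x).1 hx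
  have hq : ∃ q ∈ [qa, qb, qc, qd, qa', qb', qc', qd'], aut q = s := by
    rcases hs with rfl | rfl | rfl | rfl | rfl | rfl | rfl | rfl
    · exact ⟨qa, by decide, rfl⟩
    · exact ⟨qb, by decide, rfl⟩
    · exact ⟨qc, by decide, rfl⟩
    · exact ⟨qd, by decide, rfl⟩
    · exact ⟨qa', by decide, aut_Qinv qa⟩
    · exact ⟨qb', by decide, aut_Qinv qb⟩
    · exact ⟨qc', by decide, aut_Qinv qc⟩
    · exact ⟨qd', by decide, aut_Qinv qd⟩
  obtain ⟨q, hq, rfl⟩ := hq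
  obtain ⟨y, hy, h⟩ := chk_sound v (push q n) (by rw [hv]; exact chk_all q hq n hn)
  refine ⟨ev y, (mem_N _).2 ⟨y, hy, rfl⟩, fun u => ?_⟩
  rw [← ev_push]
  exact h u

end BVTree
end
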